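/- Let 𝓡 = (R, <, +, 0, …) be an expansion of a densely linearly ordered abelian group with 𝓡 ⊨ DC and 𝓡 ⊨ LUF₂. Let X ⊆ R^n be a D_Σ-set with nonempty interior, and let X = X₁ ∪ X₂ be a partition of X into two D_Σ-sets. Then at least one of X₁ and X₂ has nonempty interior. -/

import Mathlib

open FirstOrder Set Topology

section CommonDefs

/-- A subset of `R^n` (coded as `Fin n → R`) is definable in the structure `𝓡` (with
universe `R` and language `L`) with parameters. -/
def IsDefinable (L : FirstOrder.Language) {R : Type*} [L.Structure R] {n : ℕ}
    (X : Set (Fin n → R)) : Prop :=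
  Set.Definable (Set.univ : Set R) L X

/-- An open box in `R^n`: a product of `n` open intervals. -/
def OpenBox {R : Type*} [LT R] {n : ℕ} (B : Set (Fin n → R)) : Prop :=
  ∃ c d : Fin n → R, B = {x | ∀ i, c i < x i ∧ x i < d i}

/-- A closed box in `R^n`: a product of `n` closed intervals. -/
def ClosedBox {R : Type*} [LE R] {n : ℕ} (B : Set (Fin n → R)) : Prop :=
  ∃ c d : Fin n → R, B = {x | ∀ i, c i ≤ x i ∧ x i ≤ d i}

/-- A subset of `R` which is a finite union of points and open intervals. -/
def FinUnionPtsIntervals {R : Type*} [Preorder R] (s : Set R) : Prop :=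
  ∃ (P : Finset R) (Q : Finset (R × R)), s = ↑P ∪ ⋃ p ∈ Q, Set.Ioo p.1 p.2

/-- The fiber `X_x ⊆ R` of a set `X ⊆ R^{m+1}` over `x ∈ R^m`. -/
def fiber1 {R : Type*} {m : ℕ} (X : Set (Fin (m + 1) → R)) (x : Fin m → R) : Set R :=
  {y | Fin.snoc x y ∈ X}

/-- The fiber `X_x ⊆ R^n` of a set `X ⊆ R^{m+n}` over `x ∈ R^m`. -/
def fiberN {R : Type*} {m n : ℕ} (X : Set (Fin (m + n) → R)) (x : Fin m → R) :
    Set (Fin n → R) :=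
  {y | Fin.append x y ∈ X}

/-- The member `X_{r,s} ⊆ R^n` of a parameterized family coded by `F ⊆ R^{2+n}`. -/
def famFiber {R : Type*} {n : ℕ} (F : Set (Fin (2 + n) → R)) (r s : R) : Set (Fin n → R) :=
  {y | Fin.append ![r, s] y ∈ F}

/-- A bounded subset of `R^n`: contained in some closed box. -/
def BddSet {R : Type*} [LE R] {n : ℕ} (X : Set (Fin n → R)) : Prop :=
  ∃ c d : R, ∀ y ∈ X, ∀ i, c ≤ y i ∧ y i ≤ d

/-- A discrete subset of a topological space: each of its points is isolated. -/
def DiscreteSet {α : Type*} [TopologicalSpace α] (S : Set α) : Prop :=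
  ∀ y ∈ S, ∃ U : Set α, IsOpen U ∧ y ∈ U ∧ U ∩ S = {y}

/-- A locally finite subset: each point of the space has an open neighborhood meeting
the set in a finite set. -/
def LocFin {α : Type*} [TopologicalSpace α] (S : Set α) : Prop :=
  ∀ x : α, ∃ U : Set α, IsOpen U ∧ x ∈ U ∧ (S ∩ U).Finite

/-- `F ⊆ R^{2+n}` codes a `D_Σ`-family `{X_{r,s}}_{r>0,s>0}` of CBD subsets of `R^n`:
each fiber is closed, bounded and definable, the family is increasing in `r` and
decreasing in `s`. -/
def IsDSigmaFamily (L : FirstOrder.Language) {R : Type*} [L.Structure R] [LinearOrder R]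
    [Zero R] [TopologicalSpace R] {n : ℕ} (F : Set (Fin (2 + n) → R)) : Prop :=
  IsDefinable L F ∧
    (∀ r s : R, 0 < r → 0 < s →
      IsDefinable L (famFiber F r s) ∧ IsClosed (famFiber F r s) ∧ BddSet (famFiber F r s)) ∧
    (∀ r r' s : R, 0 < r → 0 < s → r ≤ r' → famFiber F r s ⊆ famFiber F r' s) ∧
    (∀ r s s' : R, 0 < r → 0 < s → s ≤ s' → famFiber F r s' ⊆ famFiber F r s)

/-- A `D_Σ`-set: the union `⋃_{r>0,s>0} X_{r,s}` of a `D_Σ`-family. -/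
def IsDSigma (L : FirstOrder.Language) {R : Type*} [L.Structure R] [LinearOrder R]
    [Zero R] [TopologicalSpace R] {n : ℕ} (X : Set (Fin n → R)) : Prop :=
  ∃ F : Set (Fin (2 + n) → R), IsDSigmaFamily L F ∧
    X = ⋃ (r : R) (_ : 0 < r) (s : R) (_ : 0 < s), famFiber F r s

/-- Constructible sets: finite boolean combinations of open sets. -/
inductive IsConstructibleSet {α : Type*} [TopologicalSpace α] : Set α → Prop
  | of_isOpen (s : Set α) : IsOpen s → IsConstructibleSet s
  | compl (s : Set α) : IsConstructibleSet s → IsConstructibleSet sᶜ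
  | union (s t : Set α) : IsConstructibleSet s → IsConstructibleSet t →
      IsConstructibleSet (s ∪ t)

/-- `𝓡 ⊨ DC`: every nonempty definable subset of `R` bounded above has a supremum. -/
def DCProp (L : FirstOrder.Language) (R : Type*) [L.Structure R] [Preorder R] : Prop :=
  ∀ s : Set R, IsDefinable L {v : Fin 1 → R | v 0 ∈ s} → s.Nonempty → BddAbove s →
    ∃ a : R, IsLUB s a

/-- `𝓡 ⊨ LUF₂` (locally uniform finiteness of the second kind). -/
def LUF2 (L : FirstOrder.Language) (R : Type*) [L.Structure R] [LinearOrder R]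
    [TopologicalSpace R] : Prop :=
  ∀ (m : ℕ) (X : Set (Fin (m + 1) → R)), IsDefinable L X → ∀ (a : R) (b : Fin m → R),
    ∃ N : ℕ, 0 < N ∧ ∃ p q : R, a ∈ interior (Set.Icc p q) ∧
      ∃ U : Set (Fin m → R), OpenBox U ∧ b ∈ U ∧
        ∀ x ∈ U, ∀ p' q' : R, a ∈ interior (Set.Icc p' q') → Set.Icc p' q' ⊆ Set.Icc p q →
          (fiber1 X x ∩ Set.Icc p' q').Infinite ∨ (fiber1 X x ∩ Set.Icc p' q').ncard ≤ N

/-- `𝓡 ⊨ LUF₁`: `LUF₂` with `U` always taken to be all of `R^m`. -/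
def LUF1 (L : FirstOrder.Language) (R : Type*) [L.Structure R] [LinearOrder R]
    [TopologicalSpace R] : Prop :=
  ∀ (m : ℕ) (X : Set (Fin (m + 1) → R)), IsDefinable L X → ∀ a : R,
    ∃ N : ℕ, 0 < N ∧ ∃ p q : R, a ∈ interior (Set.Icc p q) ∧
      ∀ (x : Fin m → R), ∀ p' q' : R,
        a ∈ interior (Set.Icc p' q') → Set.Icc p' q' ⊆ Set.Icc p q →
          (fiber1 X x ∩ Set.Icc p' q').Infinite ∨ (fiber1 X x ∩ Set.Icc p' q').ncard ≤ N

/-- `𝓡 ⊨ SLUF`: `LUF₁` with the interval `I` chosen independently of the definable set. -/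
def SLUF (L : FirstOrder.Language) (R : Type*) [L.Structure R] [LinearOrder R]
    [TopologicalSpace R] : Prop :=
  ∀ a : R, ∃ p q : R, a ∈ interior (Set.Icc p q) ∧
    ∀ (m : ℕ) (X : Set (Fin (m + 1) → R)), IsDefinable L X →
      ∃ N : ℕ, 0 < N ∧
        ∀ (x : Fin m → R), ∀ p' q' : R,
          a ∈ interior (Set.Icc p' q') → Set.Icc p' q' ⊆ Set.Icc p q →
            (fiber1 X x ∩ Set.Icc p' q').Infinite ∨ (fiber1 X x ∩ Set.Icc p' q').ncard ≤ N

/-- The language of the open core of `𝓡`: one `n`-ary relation symbol for each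
`𝓡`-definable open subset of `R^n`. -/
def openCoreLang (L : FirstOrder.Language) (R : Type*) [L.Structure R] [TopologicalSpace R] :
    FirstOrder.Language where
  Functions := fun _ => Empty
  Relations := fun n => { s : Set (Fin n → R) // Set.Definable (Set.univ : Set R) L s ∧ IsOpen s }

/-- The open core of `𝓡`: the structure on `R` interpreting each relation symbol by the
corresponding `𝓡`-definable open set. -/
def openCoreStructure (L : FirstOrder.Language) (R : Type*) [L.Structure R]
    [TopologicalSpace R] : (openCoreLang L R).Structure R where
  funMap := fun f _ => f.elim
  RelMap := fun s x => x ∈ s.1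

/-- A set is definable in the open core of `𝓡` if it is definable (with parameters) in the
structure generated by the `𝓡`-definable open sets. -/
def DefinableInOpenCore (L : FirstOrder.Language) (R : Type*) [L.Structure R]
    [TopologicalSpace R] {n : ℕ} (X : Set (Fin n → R)) : Prop :=
  letI := openCoreStructure L R
  Set.Definable (Set.univ : Set R) (openCoreLang L R) X

/-- The local dimension `dim_x X` of `X ⊆ R^n` at `x`, an element of `{-∞} ∪ ℕ ∪ {∞}`:
the supremum of the nonnegative integers `d` such that for every open box `B` containing
`x`, some coordinate projection of `B ∩ X` to `R^d` has nonempty interior (and `-∞` if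
some open box containing `x` misses `X`). -/
noncomputable def locDim {R : Type*} [LT R] [TopologicalSpace R] {n : ℕ}
    (X : Set (Fin n → R)) (x : Fin n → R) : WithBot ℕ∞ :=
  sSup {e : WithBot ℕ∞ | ∃ d : ℕ, e = ((d : ℕ∞) : WithBot ℕ∞) ∧
    ∀ B : Set (Fin n → R), OpenBox B → x ∈ B →
      ∃ f : Fin d → Fin n, Function.Injective f ∧
        (interior ((fun y => y ∘ f) '' (B ∩ X))).Nonempty}

/-- The dimension of `X ⊆ R^n`: the supremum of the local dimensions. -/
noncomputable def setDim {R : Type*} [LT R] [TopologicalSpace R] {n : ℕ}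
    (X : Set (Fin n → R)) : WithBot ℕ∞ :=
  ⨆ x : Fin n → R, locDim X x

/-- The projective dimension of `X ⊆ R^n`: the supremum of the nonnegative integers `d`
such that some coordinate projection of `X` to `R^d` has nonempty interior (`-∞` for the
empty set). -/
noncomputable def projDim {R : Type*} [TopologicalSpace R] {n : ℕ}
    (X : Set (Fin n → R)) : WithBot ℕ∞ :=
  sSup {e : WithBot ℕ∞ | ∃ d : ℕ, e = ((d : ℕ∞) : WithBot ℕ∞) ∧
    ∃ f : Fin d → Fin n, Function.Injective f ∧
      (interior ((fun y => y ∘ f) '' X)).Nonempty}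

/-- A subset of `R` which is a union of at most `N` open intervals. -/
def UnionAtMostOpenIntervals {R : Type*} [Preorder R] (N : ℕ) (s : Set R) : Prop :=
  ∃ Q : Finset (R × R), Q.card ≤ N ∧ s = ⋃ p ∈ Q, Set.Ioo p.1 p.2

/-- A subset of `R` which is a union of at most `N₁` points and `N₂` closed intervals. -/
def UnionAtMostPtsClosedIntervals {R : Type*} [Preorder R] (N₁ N₂ : ℕ) (s : Set R) : Prop :=
  ∃ (P : Finset R) (Q : Finset (R × R)), P.card ≤ N₁ ∧ Q.card ≤ N₂ ∧
    s = ↑P ∪ ⋃ p ∈ Q, Set.Icc p.1 p.2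

/-- A subset of `R` which is a union of at most `N₁` points and `N₂` open intervals. -/
def UnionAtMostPtsOpenIntervals {R : Type*} [Preorder R] (N₁ N₂ : ℕ) (s : Set R) : Prop :=
  ∃ (P : Finset R) (Q : Finset (R × R)), P.card ≤ N₁ ∧ Q.card ≤ N₂ ∧
    s = ↑P ∪ ⋃ p ∈ Q, Set.Ioo p.1 p.2

/-- `X ∩ B` is the graph of a continuous map defined on the coordinate-projection image
of `B` (the projection being given by the injection `f` of coordinates). -/
def IsGraphOn {R : Type*} [TopologicalSpace R] {n d : ℕ} (f : Fin d → Fin n)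
    (S : Set (Fin n → R)) (D : Set (Fin d → R)) : Prop :=
  ∃ g : (Fin d → R) → (Fin n → R), ContinuousOn g D ∧ (∀ z ∈ D, (g z) ∘ f = z) ∧ S = g '' D

end CommonDefs


namespace DS

universe u v w

/-- Types coordinatized by finitely many elements of `R`. -/
class Coord (R : outParam (Type u)) (E : Type u) where
  idx : Type
  fin : Finite idx
  toC : E → idx → R
  ofC : (idx → R) → E
  to_of : ∀ v, toC (ofC v) = v
  of_to : ∀ e, ofC (toC e) = e

attribute [instance] Coord.fin
attribute [simp] Coord.to_of Coord.of_to

/-- `R` itself, as a coordinatized type. -/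
instance coordSelf {R : Type u} : Coord R R where
  idx := Unit
  fin := inferInstance
  toC e := fun _ => e
  ofC v := v ()
  to_of _ := rfl
  of_to _ := rfl

instance coordPi {R : Type u} {n : ℕ} : Coord R (Fin n → R) where
  idx := Fin n
  fin := inferInstance
  toC := id
  ofC := id
  to_of _ := rfl
  of_to _ := rfl

instance coordProd {R : Type u} {E F : Type u} [Coord R E] [Coord R F] : Coord R (E × F) where
  idx := Coord.idx E ⊕ Coord.idx F
  fin := inferInstance
  toC e := Sum.elim (Coord.toC e.1) (Coord.toC e.2)
  ofC v := (Coord.ofC (v ∘ Sum.inl), Coord.ofC (v ∘ Sum.inr))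
  to_of v := by simp
  of_to e := by simp

section

variable {R : Type u} (L : FirstOrder.Language.{v, w}) [L.Structure R]
variable {E F G : Type u} [Coord R E] [Coord R F] [Coord R G]

/-- Definable predicates. -/
def DP (P : E → Prop) : Prop :=
  Set.Definable (Set.univ : Set R) L {v : Coord.idx E → R | P (Coord.ofC v)}

/-- Definable maps. -/
def DF (f : E → F) : Prop :=
  Set.DefinableMap L (Set.univ : Set R)
    (fun v : Coord.idx E → R => Coord.toC (f (Coord.ofC v)))

variable {L}

theorem DP.congr {P Q : E → Prop} (h : DP L P) (hPQ : ∀ e, Q e ↔ P e) : DP L Q := by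
  have : Q = P := funext fun e => propext (hPQ e)
  rw [this]; exact h

theorem DP.comp {P : F → Prop} {f : E → F} (hP : DP L P) (hf : DF L f) :
    DP L (fun e => P (f e)) := by
  have := Set.Definable.preimage_map hf hP
  unfold DP
  convert this using 1
  ext v
  simp

theorem DF.comp {g : F → G} {f : E → F} (hg : DF L g) (hf : DF L f) :
    DF L (fun e => g (f e)) := by
  intro i
  have := Set.DefinableFun.comp hf (hg i)
  simpa using this

theorem DF.id : DF L (fun e : E => e) := by
  intro i
  simp only [Coord.to_of]
  exact Set.DefinableFun.proj L

theorem DF.const (c : F) : DF L (fun _ : E => c) := by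
  intro i
  exact L.definableFun_const _ (Set.mem_univ _)

theorem DF.mk {f : E → F} {g : E → G} (hf : DF L f) (hg : DF L g) :
    DF L (fun e => (f e, g e)) := by
  rintro (i | i)
  · exact hf i
  · exact hg i

theorem DF.fst {f : E → F × G} (hf : DF L f) : DF L (fun e => (f e).1) :=
  fun i => hf (Sum.inl i)

theorem DF.snd {f : E → F × G} (hf : DF L f) : DF L (fun e => (f e).2) :=
  fun i => hf (Sum.inr i)

theorem DF.pi {n : ℕ} {f : E → (Fin n → R)} (hf : ∀ i, DF L (fun e => f e i)) : DF L f :=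
  fun i => hf i ()

theorem DF.app {n : ℕ} {f : E → (Fin n → R)} (hf : DF L f) (i : Fin n) :
    DF L (fun e => f e i) :=
  fun _ => hf i

theorem DP.and {P Q : E → Prop} (hP : DP L P) (hQ : DP L Q) : DP L (fun e => P e ∧ Q e) :=
  Set.Definable.inter hP hQ

theorem DP.or {P Q : E → Prop} (hP : DP L P) (hQ : DP L Q) : DP L (fun e => P e ∨ Q e) :=
  Set.Definable.union hP hQ

theorem DP.not {P : E → Prop} (hP : DP L P) : DP L (fun e => ¬ P e) :=
  Set.Definable.compl hP

theorem DP.imp {P Q : E → Prop} (hP : DP L P) (hQ : DP L Q) : DP L (fun e => P e → Q e) :=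
  (hP.not.or hQ).congr fun e => by tauto

theorem DP.ex {P : E → F → Prop} (hP : DP L (fun q : E × F => P q.1 q.2)) :
    DP L (fun e => ∃ x, P e x) := by
  have := Set.Definable.exists_of_finite hP
  unfold DP
  convert this using 1
  ext v
  constructor
  · rintro ⟨x, hx⟩
    refine ⟨Coord.toC x, ?_⟩
    change P (Coord.ofC (Sum.elim v (Coord.toC x) ∘ Sum.inl))
      (Coord.ofC (Sum.elim v (Coord.toC x) ∘ Sum.inr))
    simpa using hx
  · rintro ⟨x, hx⟩
    exact ⟨_, hx⟩

theorem DP.all {P : E → F → Prop} (hP : DP L (fun q : E × F => P q.1 q.2)) :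
    DP L (fun e => ∀ x, P e x) :=
  (DP.ex (P := fun e x => ¬ P e x) hP.not).not.congr fun e => by simp

theorem DP.allFin {n : ℕ} {P : E → Fin n → Prop} (hP : ∀ i, DP L (fun e => P e i)) :
    DP L (fun e => ∀ i, P e i) := by
  have := Set.definable_iInter_of_finite hP
  unfold DP
  convert this using 1
  ext v
  simp

theorem DP.triv (p : Prop) : DP L (fun _ : E => p) := by
  by_cases h : p
  · have := Set.definable_univ (L := L) (A := (Set.univ : Set R)) (α := Coord.idx E)
    unfold DP
    convert this using 1
    ext v
    simp [h]
  · have := Set.definable_empty (L := L) (A := (Set.univ : Set R)) (α := Coord.idx E)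
    unfold DP
    convert this using 1
    ext v
    simp [h]

theorem DP.exFin {n : ℕ} {P : E → Fin n → Prop} (hP : ∀ i, DP L (fun e => P e i)) :
    DP L (fun e => ∃ i, P e i) :=
  (DP.allFin fun i => (hP i).not).not.congr fun e => by simp

theorem DP.eq {f g : E → R} (hf : DF L f) (hg : DF L g) : DP L (fun e => f e = g e) :=
  Set.DefinableFun.ofPred_eq (hf ()) (hg ())

theorem DP.ofDef {n : ℕ} {X : Set (Fin n → R)} (hX : IsDefinable L X)
    {f : E → (Fin n → R)} (hf : DF L f) : DP L (fun e => f e ∈ X) :=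
  DP.comp (P := fun x => x ∈ X) hX hf

theorem DP.toDef {n : ℕ} {P : (Fin n → R) → Prop} (hP : DP L P) :
    IsDefinable L {x | P x} := hP

theorem DP.fam {X : R → R → Set F}
    (hX : DP L (fun p : (R × R) × F => p.2 ∈ X p.1.1 p.1.2))
    {r s : E → R} {y : E → F} (hr : DF L r) (hs : DF L s) (hy : DF L y) :
    DP L (fun e => y e ∈ X (r e) (s e)) :=
  DP.comp hX ((hr.mk hs).mk hy)

theorem DP.fam1 {Z : R → Set F}
    (hZ : DP L (fun p : R × F => p.2 ∈ Z p.1))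
    {r : E → R} {y : E → F} (hr : DF L r) (hy : DF L y) :
    DP L (fun e => y e ∈ Z (r e)) :=
  DP.comp hZ (hr.mk hy)

end

/-- The first-order data: order and addition are definable. -/
structure Good {R : Type u} (L : FirstOrder.Language.{v, w}) [L.Structure R]
    [LinearOrder R] [AddCommGroup R] : Prop where
  lt : IsDefinable L {v : Fin 2 → R | v 0 < v 1}
  add : IsDefinable L {v : Fin 3 → R | v 0 + v 1 = v 2}

section

variable {R : Type u} {L : FirstOrder.Language.{v, w}} [L.Structure R]
variable [LinearOrder R] [AddCommGroup R]
variable {E F G : Type u} [Coord R E] [Coord R F] [Coord R G]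

theorem DP.lt (h : Good (R := R) L) {f g : E → R} (hf : DF L f) (hg : DF L g) :
    DP L (fun e => f e < g e) := by
  have : DF L (fun e => (![f e, g e] : Fin 2 → R)) := by
    refine DF.pi fun i => ?_
    fin_cases i
    · exact hf
    · exact hg
  exact DP.ofDef h.lt this

theorem DP.le (h : Good (R := R) L) {f g : E → R} (hf : DF L f) (hg : DF L g) :
    DP L (fun e => f e ≤ g e) :=
  (DP.lt h hg hf).not.congr fun e => by simp

theorem DF.add (h : Good (R := R) L) {f g : E → R} (hf : DF L f) (hg : DF L g) :
    DF L (fun e => f e + g e) := by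
  have key : Set.DefinableFun L Set.univ (fun v : Fin 2 → R => v 0 + v 1) := by
    have := Set.Definable.preimage_comp (β := Option (Fin 2))
      (![some 0, some 1, none] : Fin 3 → Option (Fin 2)) h.add
    unfold Set.DefinableFun
    convert this using 1
    ext v
    simp [Function.tupleGraph]
  have h2 : DF L (fun v : Fin 2 → R => v 0 + v 1) := fun _ => key
  have : DF L (fun e => (![f e, g e] : Fin 2 → R)) := by
    refine DF.pi fun i => ?_
    fin_cases i
    · exact hf
    · exact hg
  exact DF.comp h2 this

theorem DF.sub (h : Good (R := R) L) {f g : E → R} (hf : DF L f) (hg : DF L g) :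
    DF L (fun e => f e - g e) := by
  have key : Set.DefinableFun L Set.univ (fun v : Fin 2 → R => v 0 - v 1) := by
    have := Set.Definable.preimage_comp (β := Option (Fin 2))
      (![none, some 1, some 0] : Fin 3 → Option (Fin 2)) h.add
    unfold Set.DefinableFun
    convert this using 1
    ext v
    simp only [Function.tupleGraph, Set.mem_preimage]
    exact sub_eq_iff_eq_add.trans eq_comm
  have h2 : DF L (fun v : Fin 2 → R => v 0 - v 1) := fun _ => key
  have : DF L (fun e => (![f e, g e] : Fin 2 → R)) := by
    refine DF.pi fun i => ?_
    fin_cases i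
    · exact hf
    · exact hg
  exact DF.comp h2 this

end

end DS

namespace DS

universe u v w

/-- Local finiteness of subsets of `R`. -/
def LF {R : Type u} [LinearOrder R] (S : Set R) : Prop :=
  ∀ a : R, ∃ l r, l < a ∧ a < r ∧ (S ∩ Set.Ioo l r).Finite

theorem card_le_iff {R : Type u} (S : Set R) (N : ℕ) :
    (∀ z : Fin (N + 1) → R, (∀ i, z i ∈ S) → ∃ i j, i ≠ j ∧ z i = z j) ↔
      S.Finite ∧ S.ncard ≤ N := by
  constructor
  · intro h
    have : S.encard ≤ N := by
      by_contra hc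
      have h1 : ((N + 1 : ℕ) : ℕ∞) ≤ S.encard := by
        have := Order.add_one_le_of_lt (not_le.1 hc)
        exact_mod_cast this
      obtain ⟨T, hTS, hT⟩ := Set.exists_subset_encard_eq h1
      have hTf : T.Finite := Set.finite_of_encard_eq_coe hT
      have hcard : Nat.card T = N + 1 := by
        rw [Nat.card_coe_set_eq, Set.ncard, hT]; rfl
      haveI := hTf.to_subtype
      let e := (Finite.equivFinOfCardEq hcard).symm
      obtain ⟨i, j, hij, he⟩ := h (fun i => (e i : R)) (fun i => hTS (e i).2)
      exact hij (e.injective (Subtype.ext he))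
    have hf : S.Finite := Set.finite_of_encard_le_coe this
    refine ⟨hf, ?_⟩
    rw [← hf.cast_ncard_eq] at this
    exact_mod_cast this
  · rintro ⟨hf, hN⟩ z hz
    by_contra hc
    push Not at hc
    have hinj : Function.Injective z := fun i j hij => by
      by_contra hne
      exact hc i j hne hij
    have h1 : (Set.range z).ncard = N + 1 := by
      rw [← Set.image_univ, Set.ncard_image_of_injective _ hinj, Set.ncard_univ]
      simp
    have h2 : (Set.range z).ncard ≤ S.ncard :=
      Set.ncard_le_ncard (by rintro _ ⟨i, rfl⟩; exact hz i) hf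
    omega

section

variable {R : Type u} {L : FirstOrder.Language.{v, w}} [L.Structure R]
variable [LinearOrder R] [DenselyOrdered R] [AddCommGroup R] [IsOrderedAddMonoid R]
variable [Nontrivial R] [TopologicalSpace R] [OrderTopology R]

theorem exists_lub (hDC : DCProp L R) {s : Set R} (hs : DP L (fun y : R => y ∈ s))
    (h1 : s.Nonempty) (h2 : BddAbove s) : ∃ a, IsLUB s a :=
  hDC s (DP.toDef (DP.comp hs (DF.app DF.id 0))) h1 h2

theorem hb (hG : Good (R := R) L) (hDC : DCProp L R) {Q : R → Prop} (hQ : DP L Q) {c d : R}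
    (hcd : c ≤ d) (h0 : Q c)
    (hstep : ∀ y, c ≤ y → y ≤ d → ∃ l r, l < y ∧ y < r ∧
      ∀ u v, l < u → u ≤ v → v < r → c ≤ u → v ≤ d → Q u → Q v) : Q d := by
  obtain ⟨y, hy⟩ := exists_lub (s := {y | c ≤ y ∧ y ≤ d ∧ Q y}) hDC
    (by simp only [Set.mem_setOf_eq]; repeat' (first
                                        | assumption
                                        | apply DP.and | apply DP.or | apply DP.not | apply DP.imp | apply DP.ex | apply DP.all
                                        | (refine DP.allFin fun _ => ?_) | (refine DP.exFin fun _ => ?_)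
                                        | apply DP.lt hG | apply DP.le hG | apply DP.eq | apply DP.triv
                                        | apply DP.fam hX | apply DP.fam1 hZ | apply hCC
                                        | apply DF.const | apply DF.id | apply DF.add hG | apply DF.sub hG
                                        | apply DF.fst | apply DF.snd | apply DF.mk | apply DF.app)) ⟨c, le_rfl, hcd, h0⟩ ⟨d, fun y hy => hy.2.1⟩
  have hcy : c ≤ y := hy.1 ⟨le_rfl, hcd, h0⟩
  have hyd : y ≤ d := hy.2 fun z hz => hz.2.1
  obtain ⟨l, r, hl, hr, h⟩ := hstep y hcy hyd
  obtain ⟨u, hu, hlu, huy⟩ := hy.exists_between hl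
  rcases hyd.eq_or_lt with rfl | hlt
  · exact h u y hlu huy hr hu.1 le_rfl hu.2.2
  · obtain ⟨v, hv1, hv2⟩ := exists_between (lt_min hlt hr)
    have hv3 := hv2.trans_le (min_le_left _ _)
    have hv4 := hv2.trans_le (min_le_right _ _)
    have : Q v := h u v hlu (huy.trans hv1.le) hv4 hu.1 hv3.le hu.2.2
    exact absurd (hy.1 ⟨hcy.trans hv1.le, hv3.le, this⟩) (not_le.2 hv1)

theorem keyK (hG : Good (R := R) L) (hDC : DCProp L R) (hLUF : LUF2 L R) (Z : R → Set R)
    (hZ : DP L (fun p : R × R => p.2 ∈ Z p.1))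
    (hmono : ∀ t t', 0 < t → t ≤ t' → Z t' ⊆ Z t)
    (hfin : ∀ t, 0 < t → LF (Z t)) : LF {y | ∃ t, 0 < t ∧ y ∈ Z t} := by
  intro a
  obtain ⟨N, hN, p, q, ha, U, ⟨c, d, hU⟩, hbU, hmain⟩ :=
    hLUF 1 {v : Fin 2 → R | v 1 ∈ Z (v 0)}
      (DP.toDef (DP.fam1 hZ (DF.app DF.id 0) (DF.app DF.id 1))) a (fun _ => 0)
  have hfib : ∀ x : Fin 1 → R, fiber1 {v : Fin 2 → R | v 1 ∈ Z (v 0)} x = Z (x 0) := by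
    intro x
    ext y
    rfl
  rw [interior_Icc] at ha
  rw [hU] at hbU
  have hc0 := (hbU 0).1
  have hd0 := (hbU 0).2
  set D := min (a - p) (q - a) with hD
  have hDpos : 0 < D := lt_min (sub_pos.2 ha.1) (sub_pos.2 ha.2)
  have hDp : p ≤ a - D := by
    have := min_le_left (a - p) (q - a)
    rw [le_sub_comm]; exact this
  have hDq : a + D ≤ q := by
    have := min_le_right (a - p) (q - a)
    rw [← le_sub_iff_add_le']; exact this
  have claim : ∀ t, 0 < t → t < d 0 →
      (Z t ∩ Set.Icc (a - D) (a + D)).Finite ∧ (Z t ∩ Set.Icc (a - D) (a + D)).ncard ≤ N := by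
    intro t ht htd
    have luf : ∀ y, 0 < y → y ≤ D → (Z t ∩ Set.Icc (a - y) (a + y)).Finite →
        (Z t ∩ Set.Icc (a - y) (a + y)).ncard ≤ N := by
      intro y hy hyD hf
      have := hmain (fun _ => t) (by
        rw [hU]; intro i
        rw [Subsingleton.elim i 0]
        exact ⟨hc0.trans ht, htd⟩) (a - y) (a + y)
        (by rw [interior_Icc]; exact ⟨sub_lt_self _ hy, lt_add_of_pos_right _ hy⟩)
        (Set.Icc_subset_Icc (hDp.trans (sub_le_sub_left hyD a))
          ((add_le_add_right hyD a).trans hDq))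
      rw [hfib] at this
      exact this.resolve_left (fun h => h hf)
    rw [← card_le_iff]
    refine hb (Q := fun y => ∀ z : Fin (N + 1) → R,
      (∀ i, z i ∈ Z t ∧ a - y ≤ z i ∧ z i ≤ a + y) → ∃ i j, i ≠ j ∧ z i = z j)
      hG hDC ?_ hDpos.le ?_ ?_
    · repeat' (first
        | assumption
        | apply DP.and | apply DP.or | apply DP.not | apply DP.imp | apply DP.ex | apply DP.all
        | (refine DP.allFin fun _ => ?_) | (refine DP.exFin fun _ => ?_)
        | apply DP.lt hG | apply DP.le hG | apply DP.eq | apply DP.triv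
        | apply DP.fam hX | apply DP.fam1 hZ | apply hCC
        | apply DF.const | apply DF.id | apply DF.add hG | apply DF.sub hG
        | apply DF.fst | apply DF.snd | apply DF.mk | apply DF.app)
    · refine (card_le_iff (Z t ∩ Set.Icc (a - 0) (a + 0)) N).2 ?_
      have hsub : Z t ∩ Set.Icc (a - 0) (a + 0) ⊆ {a} := by
        intro x hx
        simpa using hx.2
      refine ⟨(Set.finite_singleton a).subset hsub, ?_⟩
      have := Set.ncard_le_ncard hsub (Set.finite_singleton a)
      rw [Set.ncard_singleton] at this
      omega
    · intro y hy0 hyD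
      obtain ⟨l1, r1, hl1, hr1, hf1⟩ := hfin t ht (a - y)
      obtain ⟨l2, r2, hl2, hr2, hf2⟩ := hfin t ht (a + y)
      refine ⟨max (a - r1) (l2 - a), min (a - l1) (r2 - a), ?_, ?_, ?_⟩
      · exact max_lt (sub_lt_comm.1 hr1) (sub_lt_iff_lt_add'.2 hl2)
      · exact lt_min (lt_sub_comm.1 hl1) (lt_sub_iff_add_lt'.2 hr2)
      · intro u v hu huv hv hu0 hvD hQu
        have hQu' := (card_le_iff (Z t ∩ Set.Icc (a - u) (a + u)) N).1 hQu
        refine (card_le_iff (Z t ∩ Set.Icc (a - v) (a + v)) N).2 ?_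
        have hu1 := (le_max_left _ _).trans_lt hu
        have hu2 := (le_max_right _ _).trans_lt hu
        have hv1 := hv.trans_le (min_le_left _ _)
        have hv2 := hv.trans_le (min_le_right _ _)
        have hfv : (Z t ∩ Set.Icc (a - v) (a + v)).Finite := by
          refine ((hQu'.1.union hf1).union hf2).subset ?_
          rintro x ⟨hx, hx1, hx2⟩
          by_cases h1 : a - u ≤ x
          · by_cases h2 : x ≤ a + u
            · exact Or.inl (Or.inl ⟨hx, h1, h2⟩)
            · refine Or.inr ⟨hx, ?_, ?_⟩
              · exact (sub_lt_iff_lt_add'.1 hu2).trans (not_le.1 h2)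
              · exact hx2.trans_lt (lt_sub_iff_add_lt'.1 hv2)
          · refine Or.inl (Or.inr ⟨hx, ?_, ?_⟩)
            · exact (lt_sub_comm.1 hv1).trans_le hx1
            · exact (not_le.1 h1).trans (sub_lt_comm.1 hu1)
        refine ⟨hfv, ?_⟩
        rcases (hu0.trans huv).eq_or_lt with h | h
        · have : u = v := le_antisymm huv (h ▸ hu0)
          rw [← this]; exact hQu'.2
        · exact luf v h hvD hfv
  refine ⟨a - D, a + D, sub_lt_self _ hDpos, lt_add_of_pos_right _ hDpos, ?_⟩
  refine ((card_le_iff _ N).1 ?_).1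
  intro z hz
  choose t ht hzt using fun i => (hz i).1
  obtain ⟨t0, ht0, ht0'⟩ := exists_between hd0
  obtain ⟨i0, hi0⟩ := Finite.exists_min t
  have hT : 0 < min t0 (t i0) := lt_min ht0 (ht i0)
  refine (card_le_iff _ N).2 (claim (min t0 (t i0)) hT ((min_le_left _ _).trans_lt ht0')) z ?_
  intro i
  exact ⟨hmono _ _ hT ((min_le_right _ _).trans (hi0 i)) (hzt i),
    (hz i).2.1.le, (hz i).2.2.le⟩

end

end DS

namespace DS

universe u v w

/-- `t`-separated sets. -/
def Sep {R : Type u} [LinearOrder R] [AddCommGroup R] (t : R) (S : Set R) : Prop :=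
  ∀ x y, x ∈ S → y ∈ S → x < y → x + t ≤ y

section

variable {R : Type u} {L : FirstOrder.Language.{v, w}} [L.Structure R]
variable [LinearOrder R] [DenselyOrdered R] [AddCommGroup R] [IsOrderedAddMonoid R]
variable [Nontrivial R] [TopologicalSpace R] [OrderTopology R]

theorem exists_half {t : R} (ht : 0 < t) : ∃ δ, 0 < δ ∧ δ + δ < t := by
  obtain ⟨a, ha, hat⟩ := exists_between ht
  have hta : 0 < t - a := sub_pos.2 hat
  obtain ⟨δ, h0, h1⟩ := exists_between (lt_min ha hta)
  refine ⟨δ, h0, ?_⟩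
  have h2 := h1.trans_le (min_le_left _ _)
  have h3 := h1.trans_le (min_le_right _ _)
  calc δ + δ < a + (t - a) := add_lt_add h2 h3
    _ = t := by abel

theorem Sep.lf {t : R} (ht : 0 < t) {S : Set R} (hS : Sep t S) : LF S := by
  intro a
  obtain ⟨δ, hδ, hδt⟩ := exists_half ht
  refine ⟨a - δ, a + δ, sub_lt_self _ hδ, lt_add_of_pos_right _ hδ, ?_⟩
  apply Set.Subsingleton.finite
  have key : ∀ x y, x ∈ S ∩ Set.Ioo (a - δ) (a + δ) → y ∈ S ∩ Set.Ioo (a - δ) (a + δ) →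
      ¬ x < y := by
    intro x y hx hy hxy
    have h1 := hS x y hx.1 hy.1 hxy
    have h2 : a - δ + (δ + δ) < x + t := add_lt_add hx.2.1 hδt
    have h3 : a - δ + (δ + δ) = a + δ := by abel
    rw [h3] at h2
    exact absurd (h2.trans_le h1) (not_lt.2 hy.2.2.le)
  intro x hx y hy
  rcases lt_trichotomy x y with h | h | h
  · exact absurd h (key x y hx hy)
  · exact h
  · exact absurd h (key y x hy hx)

theorem LF.isolated {S : Set R} (hS : LF S) (a : R) :
    ∃ ε, 0 < ε ∧ ∀ x ∈ S, a - ε < x → x < a + ε → x = a := by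
  obtain ⟨l, r, hl, hr, hf⟩ := hS a
  have h1 : IsClosed ((S ∩ Set.Ioo l r) \ {a}) := (hf.subset Set.diff_subset).isClosed
  have h2 : Set.Ioo l r ∩ ((S ∩ Set.Ioo l r) \ {a})ᶜ ∈ 𝓝 a :=
    Filter.inter_mem (Ioo_mem_nhds hl hr) (h1.isOpen_compl.mem_nhds (by simp))
  obtain ⟨l', r', ⟨hl', hr'⟩, hsub⟩ := (mem_nhds_iff_exists_Ioo_subset).1 h2
  refine ⟨min (a - l') (r' - a), lt_min (sub_pos.2 hl') (sub_pos.2 hr'), ?_⟩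
  intro x hx hx1 hx2
  have h3 : l' < x := by
    refine lt_of_le_of_lt ?_ hx1
    rw [le_sub_comm]; exact min_le_left _ _
  have h4 : x < r' := by
    refine lt_of_lt_of_le hx2 ?_
    rw [← le_sub_iff_add_le']; exact min_le_right _ _
  have h5 := hsub ⟨h3, h4⟩
  by_contra hne
  exact h5.2 ⟨⟨hx, h5.1⟩, hne⟩

/-- A closed definable set without interior is locally finite. -/
theorem closed_lf (hG : Good (R := R) L) (hDC : DCProp L R) (hLUF : LUF2 L R) (C : Set R)
    (hC : DP L (fun y : R => y ∈ C)) (hcl : IsClosed C)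
    (hno : ∀ x y, x < y → ∃ z, x < z ∧ z < y ∧ z ∉ C) : LF C := by
  have hCC : ∀ {E : Type u} [Coord R E] {f : E → R}, DF L f → DP L (fun e => f e ∈ C) :=
    fun hf => DP.comp hC hf
  have hE := keyK hG hDC hLUF (fun t => {x | x ∈ C ∧ ∀ y, x < y → y < x + t → ¬ y ∈ C})
    (by
      change DP L (fun p : R × R => p.2 ∈ C ∧ ∀ y, p.2 < y → y < p.2 + p.1 → ¬ y ∈ C)
      repeat' (first
        | assumption
        | apply DP.and | apply DP.or | apply DP.not | apply DP.imp | apply DP.ex | apply DP.all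
        | (refine DP.allFin fun _ => ?_) | (refine DP.exFin fun _ => ?_)
        | apply DP.lt hG | apply DP.le hG | apply DP.eq | apply DP.triv
        | apply DP.fam hX | apply DP.fam1 hZ | apply hCC
        | apply DF.const | apply DF.id | apply DF.add hG | apply DF.sub hG
        | apply DF.fst | apply DF.snd | apply DF.mk | apply DF.app))
    (by
      rintro t t' ht htt' x ⟨hx, hx'⟩
      exact ⟨hx, fun y h1 h2 => hx' y h1 (h2.trans_le (add_le_add_right htt' x))⟩)
    (by
      intro t ht
      refine Sep.lf ht ?_
      rintro x y ⟨hx, hx'⟩ ⟨hy, _⟩ hxy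
      by_contra hlt
      exact hx' y hxy (not_le.1 hlt) hy)
  set S : Set R := {y | ∃ t, 0 < t ∧ y ∈ C ∧ ∀ z, y < z → z < y + t → ¬ z ∈ C} with hS
  have hE' : LF S := hE
  suffices hsub : C ⊆ S by
    intro a
    obtain ⟨l, r, hl, hr, hf⟩ := hE' a
    exact ⟨l, r, hl, hr, hf.subset (Set.inter_subset_inter_left _ hsub)⟩
  intro x hx
  by_contra hxS
  obtain ⟨ε, hε, hiso⟩ := hE'.isolated x
  have : ∃ y, x < y ∧ y < x + ε ∧ y ∈ C := by
    by_contra hc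
    push Not at hc
    exact hxS ⟨ε, hε, hx, hc⟩
  obtain ⟨y, hxy, hyε, hyC⟩ := this
  obtain ⟨z, hxz, hzy, hzC⟩ := hno x y hxy
  obtain ⟨e, he⟩ := exists_lub (s := {w | w ∈ C ∧ w ≤ z}) hDC
    (by
      change DP L (fun w : R => w ∈ C ∧ w ≤ z)
      repeat' (first
        | assumption
        | apply DP.and | apply DP.or | apply DP.not | apply DP.imp | apply DP.ex | apply DP.all
        | (refine DP.allFin fun _ => ?_) | (refine DP.exFin fun _ => ?_)
        | apply DP.lt hG | apply DP.le hG | apply DP.eq | apply DP.triv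
        | apply DP.fam hX | apply DP.fam1 hZ | apply hCC
        | apply DF.const | apply DF.id | apply DF.add hG | apply DF.sub hG
        | apply DF.fst | apply DF.snd | apply DF.mk | apply DF.app))
    ⟨x, hx, hxz.le⟩ ⟨z, fun w hw => hw.2⟩
  have heC : e ∈ C := by
    have h1 := he.mem_closure ⟨x, hx, hxz.le⟩
    have h2 : closure {w | w ∈ C ∧ w ≤ z} ⊆ C := closure_minimal (fun w hw => hw.1) hcl
    exact h2 h1
  have hez : e ≤ z := he.2 fun w hw => hw.2
  have hez' : e < z := lt_of_le_of_ne hez (fun h => hzC (h ▸ heC))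
  have hxe : x ≤ e := he.1 ⟨hx, hxz.le⟩
  have heS : e ∈ S := by
    refine ⟨z - e, sub_pos.2 hez', heC, ?_⟩
    intro w hw1 hw2 hwC
    have : w < z := by simpa using hw2
    exact absurd (he.1 ⟨hwC, this.le⟩) (not_le.2 hw1)
  have := hiso e heS ((sub_lt_self x hε).trans_le hxe) (hez'.trans (hzy.trans hyε))
  exact hxS (this ▸ heS)

/-- The Baire property for increasing families in one variable. -/
theorem one_dim (hG : Good (R := R) L) (hDC : DCProp L R) (hLUF : LUF2 L R)
    (X : R → R → Set R) (hX : DP L (fun p : (R × R) × R => p.2 ∈ X p.1.1 p.1.2))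
    (hcl : ∀ r s, 0 < r → 0 < s → IsClosed (X r s))
    (hm1 : ∀ r r' s, 0 < r → 0 < s → r ≤ r' → X r s ⊆ X r' s)
    (hm2 : ∀ r s s', 0 < r → 0 < s → s ≤ s' → X r s' ⊆ X r s)
    {c d : R} (hcd : c < d) (hcov : ∀ y, c ≤ y → y ≤ d → ∃ r s, 0 < r ∧ 0 < s ∧ y ∈ X r s) :
    ∃ r s, 0 < r ∧ 0 < s ∧ ∃ x y, x < y ∧ c ≤ x ∧ y ≤ d ∧ ∀ z, x ≤ z → z ≤ y → z ∈ X r s := by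
  by_contra hc
  -- the truncated family
  have hX0 : ∀ r s, 0 < r → 0 < s → LF {y | y ∈ X r s ∧ c ≤ y ∧ y ≤ d} := by
    intro r s hr hs
    apply closed_lf hG hDC hLUF
    · change DP L (fun y : R => y ∈ X r s ∧ c ≤ y ∧ y ≤ d)
      repeat' (first
        | assumption
        | apply DP.and | apply DP.or | apply DP.not | apply DP.imp | apply DP.ex | apply DP.all
        | (refine DP.allFin fun _ => ?_) | (refine DP.exFin fun _ => ?_)
        | apply DP.lt hG | apply DP.le hG | apply DP.eq | apply DP.triv
        | apply DP.fam hX | apply DP.fam1 hZ | apply hCC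
        | apply DF.const | apply DF.id | apply DF.add hG | apply DF.sub hG
        | apply DF.fst | apply DF.snd | apply DF.mk | apply DF.app)
    · exact (hcl r s hr hs).inter isClosed_Icc
    · intro x y hxy
      by_contra hno
      push Not at hno
      obtain ⟨x', h1, h2⟩ := exists_between hxy
      obtain ⟨y', h3, h4⟩ := exists_between h2
      refine hc ⟨r, s, hr, hs, x', y', h3, (hno x' h1 h2).2.1,
        (hno y' (h1.trans h3) h4).2.2, fun z hz1 hz2 => ?_⟩
      exact (hno z (h1.trans_le hz1) (hz2.trans_lt h4)).1
  have hY : ∀ r, 0 < r → LF {y | ∃ s, 0 < s ∧ y ∈ {y | y ∈ X r s ∧ c ≤ y ∧ y ≤ d}} := by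
    intro r hr
    apply keyK hG hDC hLUF (fun s => {y | y ∈ X r s ∧ c ≤ y ∧ y ≤ d})
    · change DP L (fun p : R × R => p.2 ∈ X r p.1 ∧ c ≤ p.2 ∧ p.2 ≤ d)
      repeat' (first
        | assumption
        | apply DP.and | apply DP.or | apply DP.not | apply DP.imp | apply DP.ex | apply DP.all
        | (refine DP.allFin fun _ => ?_) | (refine DP.exFin fun _ => ?_)
        | apply DP.lt hG | apply DP.le hG | apply DP.eq | apply DP.triv
        | apply DP.fam hX | apply DP.fam1 hZ | apply hCC
        | apply DF.const | apply DF.id | apply DF.add hG | apply DF.sub hG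
        | apply DF.fst | apply DF.snd | apply DF.mk | apply DF.app)
    · rintro t t' ht htt' y ⟨hy, hy'⟩
      exact ⟨hm2 r t t' hr ht htt' hy, hy'⟩
    · intro t ht
      exact hX0 r t hr ht
  obtain ⟨Y, hYmem⟩ : ∃ Y : R → Set R,
      ∀ r y, y ∈ Y r ↔ ∃ s, 0 < s ∧ y ∈ X r s ∧ c ≤ y ∧ y ≤ d :=
    ⟨fun r => {y | ∃ s, 0 < s ∧ y ∈ X r s ∧ c ≤ y ∧ y ≤ d}, fun _ _ => Iff.rfl⟩
  have hY' : ∀ r, 0 < r → LF (Y r) := by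
    intro r hr
    have : Y r = {y | ∃ s, 0 < s ∧ y ∈ {y | y ∈ X r s ∧ c ≤ y ∧ y ≤ d}} :=
      Set.ext fun y => hYmem r y
    rw [this]
    exact hY r hr
  have hZ : DP L (fun p : R × R => p.2 ∈ Y p.1) := by
    simp only [hYmem]
    repeat' (first
      | assumption
      | apply DP.and | apply DP.or | apply DP.not | apply DP.imp | apply DP.ex | apply DP.all
      | (refine DP.allFin fun _ => ?_) | (refine DP.exFin fun _ => ?_)
      | apply DP.lt hG | apply DP.le hG | apply DP.eq | apply DP.triv
      | apply DP.fam hX | apply DP.fam1 hZ | apply hCC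
      | apply DF.const | apply DF.id | apply DF.add hG | apply DF.sub hG
      | apply DF.fst | apply DF.snd | apply DF.mk | apply DF.app)
  have hYm : ∀ r r', 0 < r → r ≤ r' → Y r ⊆ Y r' := by
    rintro r r' hr hrr' y hy
    obtain ⟨s, hs, hy, hy'⟩ := (hYmem _ _).1 hy
    exact (hYmem _ _).2 ⟨s, hs, hm1 r r' s hr hs hrr' hy, hy'⟩
  have hYsep : ∀ r, 0 < r → ∃ t, 0 < t ∧ Sep t (Y r) := by
    intro r hr
    have h := hb (Q := fun v => ∃ t, 0 < t ∧ ∀ x y, x ∈ Y r → y ∈ Y r → y ≤ v → x < y →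
      x + t ≤ y) (c := c) (d := d) hG hDC (by repeat' (first
                                                | assumption
                                                | apply DP.and | apply DP.or | apply DP.not | apply DP.imp | apply DP.ex | apply DP.all
                                                | (refine DP.allFin fun _ => ?_) | (refine DP.exFin fun _ => ?_)
                                                | apply DP.lt hG | apply DP.le hG | apply DP.eq | apply DP.triv
                                                | apply DP.fam hX | apply DP.fam1 hZ | apply hCC
                                                | apply DF.const | apply DF.id | apply DF.add hG | apply DF.sub hG
                                                | apply DF.fst | apply DF.snd | apply DF.mk | apply DF.app)) hcd.le ?_ ?_
    · obtain ⟨t, ht, h⟩ := h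
      refine ⟨t, ht, fun x y hx hy hxy => h x y hx hy ?_ hxy⟩
      obtain ⟨_, _, _, _, h⟩ := (hYmem _ _).1 hy
      exact h
    · refine ⟨d - c, sub_pos.2 hcd, ?_⟩
      intro x y hx hy hyc hxy
      obtain ⟨_, _, _, hx, _⟩ := (hYmem _ _).1 hx
      exact absurd (hxy.trans_le hyc) (not_lt.2 hx)
    · intro y _ _
      obtain ⟨ε, hε, hiso⟩ := (hY' r hr).isolated y
      refine ⟨y - ε, y + ε, sub_lt_self _ hε, lt_add_of_pos_right _ hε, ?_⟩
      rintro u v hu huv hv _ _ ⟨t, ht, hQ⟩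
      refine ⟨min t ε, lt_min ht hε, ?_⟩
      intro w w' hw hw' hw'v hww'
      by_cases hle : w' ≤ u
      · exact (add_le_add_right (min_le_left _ _) w).trans (hQ w w' hw hw' hle hww')
      · have h1 : w' = y := hiso w' hw' (hu.trans (not_le.1 hle)) (hw'v.trans_lt hv)
        have h2 : w ≤ y - ε := by
          by_contra hlt
          have := hiso w hw (not_le.1 hlt)
            ((hww'.trans_eq h1).trans (lt_add_of_pos_right _ hε))
          rw [this, h1] at hww'
          exact lt_irrefl _ hww'
        rw [h1]
        exact (add_le_add_right (min_le_right _ _) w).trans (le_sub_iff_add_le.1 h2)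
  have hfinal := keyK hG hDC hLUF
    (fun t => {y | ∃ r, 0 < r ∧ y ∈ Y r ∧ ∀ a b, a ∈ Y r → b ∈ Y r → a < b → a + t ≤ b})
    (by
      change DP L (fun p : R × R => ∃ r, 0 < r ∧ p.2 ∈ Y r ∧
        ∀ a b, a ∈ Y r → b ∈ Y r → a < b → a + p.1 ≤ b)
      repeat' (first
        | assumption
        | apply DP.and | apply DP.or | apply DP.not | apply DP.imp | apply DP.ex | apply DP.all
        | (refine DP.allFin fun _ => ?_) | (refine DP.exFin fun _ => ?_)
        | apply DP.lt hG | apply DP.le hG | apply DP.eq | apply DP.triv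
        | apply DP.fam hX | apply DP.fam1 hZ | apply hCC
        | apply DF.const | apply DF.id | apply DF.add hG | apply DF.sub hG
        | apply DF.fst | apply DF.snd | apply DF.mk | apply DF.app))
    (by
      rintro t t' ht htt' y ⟨r, hr, hy, h⟩
      exact ⟨r, hr, hy, fun a b ha hb hab =>
        (add_le_add_right htt' a).trans (h a b ha hb hab)⟩)
    (by
      intro t ht
      refine Sep.lf ht ?_
      rintro x y ⟨r, hr, hx, h⟩ ⟨r', hr', hy, h'⟩ hxy
      rcases le_total r r' with hrr | hrr
      · exact h' x y (hYm r r' hr hrr hx) hy hxy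
      · exact h x y hx (hYm r' r hr' hrr hy) hxy)
  obtain ⟨ε, hε, hiso⟩ := hfinal.isolated c
  obtain ⟨y, hy1, hy2⟩ := exists_between (lt_min hcd (lt_add_of_pos_right c hε))
  have hyd := hy2.trans_le (min_le_left _ _)
  have hyε := hy2.trans_le (min_le_right _ _)
  obtain ⟨r, s, hr, hs, hyX⟩ := hcov y hy1.le hyd.le
  obtain ⟨t, ht, hsep⟩ := hYsep r hr
  have := hiso y ⟨t, ht, r, hr, (hYmem _ _).2 ⟨s, hs, hyX, hy1.le, hyd.le⟩, hsep⟩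
    ((sub_lt_self _ hε).trans hy1) hyε
  exact absurd hy1 (this ▸ lt_irrefl _)

end

end DS

namespace DS

universe u v w

/-- Open boxes with a given center and radius. -/
def box {R : Type u} [LinearOrder R] [AddCommGroup R] {n : ℕ} (x : Fin n → R) (ε : R) :
    Set (Fin n → R) :=
  {y | ∀ i, x i - ε < y i ∧ y i < x i + ε}

section

variable {R : Type u} {L : FirstOrder.Language.{v, w}} [L.Structure R]
variable [LinearOrder R] [DenselyOrdered R] [AddCommGroup R] [IsOrderedAddMonoid R]
variable [Nontrivial R] [TopologicalSpace R] [OrderTopology R]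

theorem box_open {n : ℕ} (x : Fin n → R) (ε : R) : IsOpen (box x ε) := by
  have : box x ε = Set.univ.pi (fun i => Set.Ioo (x i - ε) (x i + ε)) := by
    ext y
    simp [box]
  rw [this]
  exact isOpen_set_pi Set.finite_univ (fun i _ => isOpen_Ioo)

theorem mem_box {n : ℕ} (x : Fin n → R) {ε : R} (hε : 0 < ε) : x ∈ box x ε :=
  fun i => ⟨sub_lt_self _ hε, lt_add_of_pos_right _ hε⟩

theorem box_mono {n : ℕ} (x : Fin n → R) {ε ε' : R} (h : ε ≤ ε') : box x ε ⊆ box x ε' :=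
  fun _ hy i => ⟨(sub_le_sub_left h _).trans_lt (hy i).1,
    (hy i).2.trans_le (add_le_add_right h _)⟩

theorem ioo_nhds {S : Set R} {a : R} (h : S ∈ 𝓝 a) :
    ∃ ε, 0 < ε ∧ ∀ x, a - ε < x → x < a + ε → x ∈ S := by
  obtain ⟨l, r, ⟨hl, hr⟩, hsub⟩ := mem_nhds_iff_exists_Ioo_subset.1 h
  refine ⟨min (a - l) (r - a), lt_min (sub_pos.2 hl) (sub_pos.2 hr), ?_⟩
  intro x hx1 hx2
  refine hsub ⟨lt_of_le_of_lt ?_ hx1, lt_of_lt_of_le hx2 ?_⟩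
  · rw [le_sub_comm]; exact min_le_left _ _
  · rw [← le_sub_iff_add_le']; exact min_le_right _ _

theorem box_nhds {n : ℕ} {S : Set (Fin n → R)} {x : Fin n → R} (h : S ∈ 𝓝 x) :
    ∃ ε, 0 < ε ∧ box x ε ⊆ S := by
  rw [nhds_pi, Filter.mem_pi'] at h
  obtain ⟨I, t, ht, hsub⟩ := h
  choose ε hε hmem using fun i => ioo_nhds (ht i)
  obtain ⟨e, he⟩ := exists_zero_lt (α := R)
  have : ∃ δ, 0 < δ ∧ ∀ i, δ ≤ ε i := by
    rcases isEmpty_or_nonempty (Fin n) with hn | hn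
    · exact ⟨e, he, fun i => hn.elim i⟩
    · obtain ⟨i0, hi0⟩ := Finite.exists_min ε
      exact ⟨ε i0, hε i0, hi0⟩
  obtain ⟨δ, hδ, hle⟩ := this
  refine ⟨δ, hδ, fun y hy => hsub fun i _ => ?_⟩
  have := box_mono x (hle i) hy i
  exact hmem i _ this.1 this.2

/-- Projections of closed definable sets along a closed bounded interval are closed. -/
theorem proj_closed (hG : Good (R := R) L) (hDC : DCProp L R) {n : ℕ}
    (C : Set ((Fin n → R) × R)) (hC : DP L (fun p : (Fin n → R) × R => p ∈ C))
    (hcl : IsClosed C) (c d : R) :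
    IsClosed {x | ∃ y, c ≤ y ∧ y ≤ d ∧ (x, y) ∈ C} := by
  have hCC : ∀ {E : Type u} [Coord R E] {f : E → (Fin n → R) × R}, DF L f →
    DP L (fun e => f e ∈ C) := fun hf => DP.comp hC hf
  rcases lt_or_ge d c with hdc | hcd
  · have : {x : Fin n → R | ∃ y, c ≤ y ∧ y ≤ d ∧ (x, y) ∈ C} = ∅ := by
      ext x
      simp only [Set.mem_setOf_eq, Set.mem_empty_iff_false, iff_false]
      rintro ⟨y, h1, h2, _⟩
      exact absurd (h1.trans h2) (not_le.2 hdc)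
    rw [this]; exact isClosed_empty
  rw [← isOpen_compl_iff, isOpen_iff_mem_nhds]
  intro x0 hx0
  have hx0' : ∀ y, c ≤ y → y ≤ d → (x0, y) ∉ C := fun y h1 h2 h3 => hx0 ⟨y, h1, h2, h3⟩
  have hloc : ∀ y, c ≤ y → y ≤ d → ∃ ε, 0 < ε ∧ ∃ δ, 0 < δ ∧
      ∀ x ∈ box x0 ε, ∀ z, y - δ < z → z < y + δ → (x, z) ∉ C := by
    intro y h1 h2
    have h3 : Cᶜ ∈ 𝓝 (x0, y) := hcl.isOpen_compl.mem_nhds (hx0' y h1 h2)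
    obtain ⟨A, hA, B, hB, hAB⟩ := mem_nhds_prod_iff.1 h3
    obtain ⟨ε, hε, hεA⟩ := box_nhds hA
    obtain ⟨δ, hδ, hδB⟩ := ioo_nhds hB
    exact ⟨ε, hε, δ, hδ, fun x hx z hz1 hz2 => hAB ⟨hεA hx, hδB z hz1 hz2⟩⟩
  have key := hb (Q := fun v => ∃ ε, 0 < ε ∧ ∀ x : Fin n → R,
      (∀ i, x0 i - ε < x i ∧ x i < x0 i + ε) → ∀ y, c ≤ y → y ≤ v → ¬ (x, y) ∈ C)
      (c := c) (d := d) hG hDC (by repeat' (first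
                                     | assumption
                                     | apply DP.and | apply DP.or | apply DP.not | apply DP.imp | apply DP.ex | apply DP.all
                                     | (refine DP.allFin fun _ => ?_) | (refine DP.exFin fun _ => ?_)
                                     | apply DP.lt hG | apply DP.le hG | apply DP.eq | apply DP.triv
                                     | apply DP.fam hX | apply DP.fam1 hZ | apply hCC
                                     | apply DF.const | apply DF.id | apply DF.add hG | apply DF.sub hG
                                     | apply DF.fst | apply DF.snd | apply DF.mk | apply DF.app)) hcd ?_ ?_
  · obtain ⟨ε, hε, h⟩ := key
    refine Filter.mem_of_superset ((box_open x0 ε).mem_nhds (mem_box x0 hε)) ?_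
    rintro x hx ⟨y, h1, h2, h3⟩
    exact h x hx y h1 h2 h3
  · obtain ⟨ε, hε, δ, hδ, h⟩ := hloc c le_rfl hcd
    refine ⟨ε, hε, fun x hx y h1 h2 => h x hx y ?_ ?_⟩
    · exact (sub_lt_self _ hδ).trans_le h1
    · exact h2.trans_lt (lt_add_of_pos_right _ hδ)
  · intro y h1 h2
    obtain ⟨ε, hε, δ, hδ, h⟩ := hloc y h1 h2
    refine ⟨y - δ, y + δ, sub_lt_self _ hδ, lt_add_of_pos_right _ hδ, ?_⟩
    rintro u v hu huv hv _ _ ⟨ε', hε', hQ⟩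
    refine ⟨min ε ε', lt_min hε hε', fun x hx z hz1 hz2 => ?_⟩
    by_cases hzu : z ≤ u
    · exact hQ x (box_mono x0 (min_le_right _ _) hx) z hz1 hzu
    · exact h x (box_mono x0 (min_le_left _ _) hx) z (hu.trans (not_le.1 hzu))
        (hz2.trans_lt hv)

/-- The Baire property for a coordinatized topological space. -/
def BP (L : FirstOrder.Language.{v, w}) [L.Structure R] (E : Type u) [Coord R E]
    [TopologicalSpace E] : Prop :=
  ∀ X : R → R → Set E, DP L (fun p : (R × R) × E => p.2 ∈ X p.1.1 p.1.2) →
    (∀ r s, 0 < r → 0 < s → IsClosed (X r s)) →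
    (∀ r r' s, 0 < r → 0 < s → r ≤ r' → X r s ⊆ X r' s) →
    (∀ r s s', 0 < r → 0 < s → s ≤ s' → X r s' ⊆ X r s) →
    ∀ U : Set E, IsOpen U → U.Nonempty → (∀ y ∈ U, ∃ r s, 0 < r ∧ 0 < s ∧ y ∈ X r s) →
    ∃ r s, 0 < r ∧ 0 < s ∧ (interior (X r s)).Nonempty

/-- A closed set all of whose fibers over an open set contain an interval of fixed length
has nonempty interior. -/
theorem fixed_length (hG : Good (R := R) L) (hDC : DCProp L R) {n : ℕ}
    (C : Set ((Fin n → R) × R)) (hC : DP L (fun p : (Fin n → R) × R => p ∈ C))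
    (hcl : IsClosed C) {c d s : R} (hs : 0 < s)
    (hint : (interior {x : Fin n → R | ∃ y, c ≤ y ∧ y ≤ d ∧
      ∀ z, 0 ≤ z → z ≤ s → (x, y + z) ∈ C}).Nonempty) :
    (interior C).Nonempty := by
  have hCC : ∀ {E : Type u} [Coord R E] {f : E → (Fin n → R) × R}, DF L f →
    DP L (fun e => f e ∈ C) := fun hf => DP.comp hC hf
  obtain ⟨D, hD⟩ : ∃ D : Set ((Fin n → R) × R),
      ∀ x y, (x, y) ∈ D ↔ ∀ z, 0 ≤ z → z ≤ s → (x, y + z) ∈ C :=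
    ⟨{p | ∀ z, 0 ≤ z → z ≤ s → (p.1, p.2 + z) ∈ C}, fun _ _ => Iff.rfl⟩
  have hDdef : DP L (fun p : (Fin n → R) × R => p ∈ D) := by
    have h : ∀ p : (Fin n → R) × R, p ∈ D ↔ ∀ z, 0 ≤ z → z ≤ s → (p.1, p.2 + z) ∈ C :=
      fun p => hD p.1 p.2
    simp only [h]
    repeat' (first
      | assumption
      | apply DP.and | apply DP.or | apply DP.not | apply DP.imp | apply DP.ex | apply DP.all
      | (refine DP.allFin fun _ => ?_) | (refine DP.exFin fun _ => ?_)
      | apply DP.lt hG | apply DP.le hG | apply DP.eq | apply DP.triv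
      | apply DP.fam hX | apply DP.fam1 hZ | apply hCC
      | apply DF.const | apply DF.id | apply DF.add hG | apply DF.sub hG
      | apply DF.fst | apply DF.snd | apply DF.mk | apply DF.app)
  have hDcl : IsClosed D := by
    have : D = ⋂ z, ⋂ (_ : 0 ≤ z), ⋂ (_ : z ≤ s),
        (fun p : (Fin n → R) × R => (p.1, p.2 + z)) ⁻¹' C := by
      ext ⟨x, y⟩
      simp [hD]
    rw [this]
    refine isClosed_iInter fun z => isClosed_iInter fun _ => isClosed_iInter fun _ => ?_
    exact hcl.preimage (by fun_prop)
  -- the sublevel sets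
  obtain ⟨G, hGm⟩ : ∃ G : R → Set (Fin n → R),
      ∀ e x, x ∈ G e ↔ ∃ y, c ≤ y ∧ y ≤ min d e ∧ (x, y) ∈ D :=
    ⟨fun e => {x | ∃ y, c ≤ y ∧ y ≤ min d e ∧ (x, y) ∈ D}, fun _ _ => Iff.rfl⟩
  have hGcl : ∀ e, IsClosed (G e) := by
    intro e
    have : G e = {x | ∃ y, c ≤ y ∧ y ≤ min d e ∧ (x, y) ∈ D} := Set.ext fun x => hGm e x
    rw [this]
    exact proj_closed hG hDC D hDdef hDcl c _
  have hZ : DP L (fun p : R × (Fin n → R) => p.2 ∈ G p.1) := by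
    have hDD : ∀ {E : Type u} [Coord R E] {f : E → (Fin n → R) × R}, DF L f →
      DP L (fun e => f e ∈ D) := fun hf => DP.comp hDdef hf
    clear hCC
    rename' hDD => hCC
    simp only [hGm, le_min_iff]
    repeat' (first
      | assumption
      | apply DP.and | apply DP.or | apply DP.not | apply DP.imp | apply DP.ex | apply DP.all
      | (refine DP.allFin fun _ => ?_) | (refine DP.exFin fun _ => ?_)
      | apply DP.lt hG | apply DP.le hG | apply DP.eq | apply DP.triv
      | apply DP.fam hX | apply DP.fam1 hZ | apply hCC
      | apply DF.const | apply DF.id | apply DF.add hG | apply DF.sub hG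
      | apply DF.fst | apply DF.snd | apply DF.mk | apply DF.app)
  have hmono : ∀ e e', e ≤ e' → G e ⊆ G e' := by
    intro e e' hee x hx
    obtain ⟨y, h1, h2, h3⟩ := (hGm _ _).1 hx
    exact (hGm _ _).2 ⟨y, h1, h2.trans (min_le_min_left _ hee), h3⟩
  -- the levels whose sublevel sets contain no box
  obtain ⟨S, hS⟩ : ∃ S : Set R, ∀ e, e ∈ S ↔ ¬ ∃ (x0 : Fin n → R) (ε : R), 0 < ε ∧
      ∀ x : Fin n → R, (∀ i, x0 i - ε < x i ∧ x i < x0 i + ε) → x ∈ G e :=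
    ⟨{e | ¬ ∃ (x0 : Fin n → R) (ε : R), 0 < ε ∧
      ∀ x : Fin n → R, (∀ i, x0 i - ε < x i ∧ x i < x0 i + ε) → x ∈ G e}, fun _ => Iff.rfl⟩
  have hSdef : DP L (fun e : R => e ∈ S) := by
    simp only [hS]
    repeat' (first
      | assumption
      | apply DP.and | apply DP.or | apply DP.not | apply DP.imp | apply DP.ex | apply DP.all
      | (refine DP.allFin fun _ => ?_) | (refine DP.exFin fun _ => ?_)
      | apply DP.lt hG | apply DP.le hG | apply DP.eq | apply DP.triv
      | apply DP.fam hX | apply DP.fam1 hZ | apply hCC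
      | apply DF.const | apply DF.id | apply DF.add hG | apply DF.sub hG
      | apply DF.fst | apply DF.snd | apply DF.mk | apply DF.app)
  obtain ⟨c', hc'⟩ := exists_lt c
  have hSne : S.Nonempty := by
    refine ⟨c', (hS _).2 ?_⟩
    rintro ⟨x0, ε, hε, h⟩
    obtain ⟨y, h1, h2, _⟩ := (hGm _ _).1 (h x0 (mem_box x0 hε))
    exact absurd (h1.trans (h2.trans (min_le_right _ _))) (not_le.2 hc')
  have hSbd : BddAbove S := by
    refine ⟨d, fun e he => ?_⟩
    by_contra hlt
    refine (hS _).1 he ?_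
    obtain ⟨x0, hx0⟩ := hint
    obtain ⟨ε, hε, hsub⟩ := box_nhds (mem_interior_iff_mem_nhds.1 hx0)
    refine ⟨x0, ε, hε, fun x hx => ?_⟩
    obtain ⟨y, h1, h2, h3⟩ := hsub hx
    exact (hGm _ _).2 ⟨y, h1, le_min h2 (h2.trans (not_le.1 hlt).le), (hD _ _).2 h3⟩
  obtain ⟨y1, hy1⟩ := exists_lub hDC hSdef hSne hSbd
  obtain ⟨δ, hδ, hδs⟩ := exists_half hs
  have h1 : y1 + δ ∉ S := fun h => absurd (hy1.1 h) (not_le.2 (lt_add_of_pos_right _ hδ))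
  rw [hS, not_not] at h1
  obtain ⟨x0, ε, hε, hbox⟩ := h1
  obtain ⟨e, heS, he1, he2⟩ := hy1.exists_between (sub_lt_self y1 hδ)
  have hVopen : IsOpen (box x0 ε ∩ (G (y1 - δ))ᶜ) :=
    (box_open _ _).inter (hGcl _).isOpen_compl
  have hVne : (box x0 ε ∩ (G (y1 - δ))ᶜ).Nonempty := by
    by_contra hemp
    refine (hS _).1 heS ⟨x0, ε, hε, fun x hx => ?_⟩
    refine hmono (y1 - δ) e he1.le ?_
    by_contra hx'
    exact hemp ⟨x, hx, hx'⟩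
  have hlt : y1 + δ < y1 - δ + s := by
    have : y1 + δ = y1 - δ + (δ + δ) := by abel
    rw [this]
    exact add_lt_add_right hδs _
  obtain ⟨x, hx⟩ := hVne
  obtain ⟨y, hya, hyb⟩ := exists_between hlt
  refine ⟨(x, y), ?_⟩
  have hO : IsOpen ((box x0 ε ∩ (G (y1 - δ))ᶜ) ×ˢ Set.Ioo (y1 + δ) (y1 - δ + s)) :=
    hVopen.prod isOpen_Ioo
  refine interior_maximal ?_ hO ⟨hx, hya, hyb⟩
  rintro ⟨x', y'⟩ ⟨⟨hx1, hx2⟩, hy1', hy2'⟩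
  obtain ⟨w, hw1, hw2, hw3⟩ := (hGm _ _).1 (hbox x' hx1)
  have hwlow : y1 - δ < w := by
    by_contra hle
    exact hx2 ((hGm _ _).2 ⟨w, hw1, le_min (hw2.trans (min_le_left _ _)) (not_lt.1 hle), hw3⟩)
  have := (hD _ _).1 hw3 (y' - w)
    (sub_nonneg.2 ((hw2.trans (min_le_right _ _)).trans hy1'.le))
    (sub_le_iff_le_add'.2 (hy2'.le.trans (add_le_add_left hwlow.le s)))
  simpa using this

theorem BP.step (hG : Good (R := R) L) (hDC : DCProp L R) (hLUF : LUF2 L R) {n : ℕ}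
    (ih : BP L (Fin n → R)) : BP L ((Fin n → R) × R) := by
  intro X hX hcl hm1 hm2 U hU hUne hcov
  obtain ⟨⟨x0, y0⟩, hxy⟩ := hUne
  obtain ⟨A, hA, B, hB, hAB⟩ := mem_nhds_prod_iff.1 (hU.mem_nhds hxy)
  obtain ⟨ε, hε, hεA⟩ := box_nhds hA
  obtain ⟨δ, hδ, hδB⟩ := ioo_nhds hB
  obtain ⟨d, hd1, hd2⟩ := exists_between (lt_add_of_pos_right y0 hδ)
  have hcov' : ∀ x ∈ box x0 ε, ∀ y, y0 ≤ y → y ≤ d → ∃ r s, 0 < r ∧ 0 < s ∧ (x, y) ∈ X r s :=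
    fun x hx y h1 h2 => hcov _ (hAB ⟨hεA hx, hδB y ((sub_lt_self _ hδ).trans_le h1)
      (h2.trans_lt hd2)⟩)
  have hXdef : ∀ r s, DP L (fun p : (Fin n → R) × R => p ∈ X r s) := fun r s =>
    DP.fam hX (DF.const r) (DF.const s) DF.id
  obtain ⟨Y, hY⟩ : ∃ Y : R → R → Set (Fin n → R), ∀ r s x, x ∈ Y r s ↔
      ∃ y, y0 ≤ y ∧ y ≤ d ∧ ∀ z, 0 ≤ z → z ≤ s → (x, y + z) ∈ X r s :=
    ⟨fun r s => {x | ∃ y, y0 ≤ y ∧ y ≤ d ∧ ∀ z, 0 ≤ z → z ≤ s → (x, y + z) ∈ X r s},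
      fun _ _ _ => Iff.rfl⟩
  have := ih Y ?_ ?_ ?_ ?_ (box x0 ε) (box_open _ _) ⟨x0, mem_box x0 hε⟩ ?_
  · obtain ⟨r, s, hr, hs, hne⟩ := this
    refine ⟨r, s, hr, hs, ?_⟩
    refine fixed_length hG hDC (X r s) (hXdef r s) (hcl r s hr hs) (c := y0) (d := d) hs ?_
    convert hne using 3
    ext x
    exact (hY r s x).symm
  · simp only [hY]
    repeat' (first
      | assumption
      | apply DP.and | apply DP.or | apply DP.not | apply DP.imp | apply DP.ex | apply DP.all
      | (refine DP.allFin fun _ => ?_) | (refine DP.exFin fun _ => ?_)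
      | apply DP.lt hG | apply DP.le hG | apply DP.eq | apply DP.triv
      | apply DP.fam hX | apply DP.fam1 hZ | apply hCC
      | apply DF.const | apply DF.id | apply DF.add hG | apply DF.sub hG
      | apply DF.fst | apply DF.snd | apply DF.mk | apply DF.app)
  · intro r s hr hs
    have h : Y r s = {x | ∃ y, y0 ≤ y ∧ y ≤ d ∧
        (x, y) ∈ {p : (Fin n → R) × R | ∀ z, 0 ≤ z → z ≤ s → (p.1, p.2 + z) ∈ X r s}} :=
      Set.ext fun x => hY r s x
    rw [h]
    apply proj_closed hG hDC
    · change DP L (fun p : (Fin n → R) × R => ∀ z, 0 ≤ z → z ≤ s → (p.1, p.2 + z) ∈ X r s)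
      repeat' (first
        | assumption
        | apply DP.and | apply DP.or | apply DP.not | apply DP.imp | apply DP.ex | apply DP.all
        | (refine DP.allFin fun _ => ?_) | (refine DP.exFin fun _ => ?_)
        | apply DP.lt hG | apply DP.le hG | apply DP.eq | apply DP.triv
        | apply DP.fam hX | apply DP.fam1 hZ | apply hCC
        | apply DF.const | apply DF.id | apply DF.add hG | apply DF.sub hG
        | apply DF.fst | apply DF.snd | apply DF.mk | apply DF.app)
    · have : {p : (Fin n → R) × R | ∀ z, 0 ≤ z → z ≤ s → (p.1, p.2 + z) ∈ X r s} =
          ⋂ z, ⋂ (_ : 0 ≤ z), ⋂ (_ : z ≤ s),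
          (fun p : (Fin n → R) × R => (p.1, p.2 + z)) ⁻¹' X r s := by
        ext ⟨x, y⟩
        simp
      rw [this]
      refine isClosed_iInter fun z => isClosed_iInter fun _ => isClosed_iInter fun _ => ?_
      exact (hcl r s hr hs).preimage (by fun_prop)
  · intro r r' s hr hs hrr x hx
    obtain ⟨y, h1, h2, h3⟩ := (hY _ _ _).1 hx
    exact (hY _ _ _).2 ⟨y, h1, h2, fun z hz hzs => hm1 r r' s hr hs hrr (h3 z hz hzs)⟩
  · intro r s s' hr hs hss x hx
    obtain ⟨y, h1, h2, h3⟩ := (hY _ _ _).1 hx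
    exact (hY _ _ _).2 ⟨y, h1, h2, fun z hz hzs => hm2 r s s' hr hs hss (h3 z hz (hzs.trans hss))⟩
  · intro x hx
    obtain ⟨r, s, hr, hs, a, b, hab, ha, hb, hsub⟩ :=
      one_dim hG hDC hLUF (fun r s => {y | (x, y) ∈ X r s})
        (DP.fam hX (DF.fst (DF.fst DF.id)) (DF.snd (DF.fst DF.id))
          ((DF.const x).mk (DF.snd DF.id)))
        (fun r s hr hs => (hcl r s hr hs).preimage (by fun_prop))
        (fun r r' s hr hs h y hy => hm1 r r' s hr hs h hy)
        (fun r s s' hr hs h y hy => hm2 r s s' hr hs h hy)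
        hd1 (hcov' x hx)
    have hpos : 0 < min s (b - a) := lt_min hs (sub_pos.2 hab)
    refine ⟨r, min s (b - a), hr, hpos, (hY _ _ _).2 ⟨a, ha, hab.le.trans hb, ?_⟩⟩
    intro z hz hzs
    refine hm2 r _ s hr hpos (min_le_left _ _) (hsub _ (le_add_of_nonneg_right hz) ?_)
    exact le_sub_iff_add_le'.1 (hzs.trans (min_le_right _ _))

theorem BP.all (hG : Good (R := R) L) (hDC : DCProp L R) (hLUF : LUF2 L R) (n : ℕ) :
    BP L (Fin n → R) := by
  induction n with
  | zero =>
    intro X _ _ _ _ U _ hUne hcov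
    obtain ⟨x, hx⟩ := hUne
    obtain ⟨r, s, hr, hs, h⟩ := hcov x hx
    refine ⟨r, s, hr, hs, x, ?_⟩
    have : X r s = Set.univ := Set.eq_univ_of_forall fun y => Subsingleton.elim x y ▸ h
    rw [this]; simp
  | succ n ih =>
    intro X hX hcl hm1 hm2 U hU hUne hcov
    have hcont : Continuous (fun p : (Fin n → R) × R => (Fin.snoc p.1 p.2 : Fin (n + 1) → R)) :=
      Continuous.finSnoc continuous_fst continuous_snd
    have hdf : DF L (fun p : (Fin n → R) × R => (Fin.snoc p.1 p.2 : Fin (n + 1) → R)) := by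
      refine DF.pi fun i => ?_
      refine Fin.lastCases ?_ (fun i => ?_) i
      · simp only [Fin.snoc_last]
        exact DF.snd DF.id
      · simp only [Fin.snoc_castSucc]
        exact DF.app (DF.fst DF.id) i
    have hback : Continuous (fun v : Fin (n + 1) → R => ((Fin.init v : Fin n → R), v (Fin.last n))) := by
      refine Continuous.prodMk ?_ (continuous_apply _)
      exact continuous_pi fun i => continuous_apply _
    obtain ⟨r, s, hr, hs, p, hp⟩ := BP.step hG hDC hLUF ih
      (fun r s => (fun p : (Fin n → R) × R => (Fin.snoc p.1 p.2 : Fin (n + 1) → R)) ⁻¹' X r s)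
      (DP.fam hX (DF.fst (DF.fst DF.id)) (DF.snd (DF.fst DF.id)) (DF.comp hdf (DF.snd DF.id)))
      (fun r s hr hs => (hcl r s hr hs).preimage hcont)
      (fun r r' s hr hs h p hp => hm1 r r' s hr hs h hp)
      (fun r s s' hr hs h p hp => hm2 r s s' hr hs h hp)
      _ (hU.preimage hcont)
      (by
        obtain ⟨x, hx⟩ := hUne
        refine ⟨(Fin.init x, x (Fin.last n)), ?_⟩
        simpa using hx)
      (fun p hp => hcov _ hp)
    refine ⟨r, s, hr, hs, Fin.snoc p.1 p.2, ?_⟩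
    refine interior_maximal ?_ (isOpen_interior.preimage hback) ?_
      (t := (fun v : Fin (n + 1) → R => ((Fin.init v : Fin n → R), v (Fin.last n))) ⁻¹'
        interior ((fun p : (Fin n → R) × R => (Fin.snoc p.1 p.2 : Fin (n + 1) → R)) ⁻¹' X r s))
    · intro v hv
      have := interior_subset hv
      simpa using this
    · simpa using hp

end

end DS
/-- Let `𝓡` be a definably complete expansion of a densely linearly
ordered abelian group satisfying `LUF₂`. If a `D_Σ`-set `X ⊆ R^n` with nonempty interior
is partitioned into two `D_Σ`-sets `X₁` and `X₂`, then at least one of `X₁`, `X₂` has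
nonempty interior. -/
theorem dSigma_partition_nonempty_interior
    {R : Type*} (L : FirstOrder.Language) [L.Structure R]
    [LinearOrder R] [DenselyOrdered R] [AddCommGroup R]
    [CovariantClass R R (· + ·) (· < ·)] [TopologicalSpace R] [OrderTopology R]
    (hlt : IsDefinable L {v : Fin 2 → R | v 0 < v 1})
    (hadd : IsDefinable L {v : Fin 3 → R | v 0 + v 1 = v 2})
    (hDC : DCProp L R) (hLUF2 : LUF2 L R)
    {n : ℕ} (X X₁ X₂ : Set (Fin n → R))
    (hX : IsDSigma L X) (hint : (interior X).Nonempty)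
    (hX₁ : IsDSigma L X₁) (hX₂ : IsDSigma L X₂)
    (hunion : X = X₁ ∪ X₂) (hdisj : Disjoint X₁ X₂) :
    (interior X₁).Nonempty ∨ (interior X₂).Nonempty := by
  classical
  have hG : DS.Good (R := R) L := ⟨hlt, hadd⟩
  haveI : IsOrderedAddMonoid R :=
    { add_le_add_left := fun a b hab c => by
        rcases hab.eq_or_lt with h | h
        · rw [h]
        · rw [add_comm a c, add_comm b c]
          exact (CovariantClass.elim (μ := (· + ·)) (r := (· < ·)) c h).le }
  obtain ⟨F₁, ⟨hF₁, hc₁, hr₁, hs₁⟩, hU₁⟩ := hX₁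
  obtain ⟨F₂, ⟨hF₂, hc₂, hr₂, hs₂⟩, hU₂⟩ := hX₂
  obtain ⟨x0, hx0⟩ := hint
  have hcov : ∀ x ∈ interior X, ∃ r s, 0 < r ∧ 0 < s ∧
      x ∈ famFiber F₁ r s ∪ famFiber F₂ r s := by
    intro x hx
    have := interior_subset hx
    rw [hunion, hU₁, hU₂] at this
    simp only [Set.mem_union, Set.mem_iUnion] at this
    rcases this with ⟨r, hr, s, hs, h⟩ | ⟨r, hr, s, hs, h⟩
    · exact ⟨r, s, hr, hs, Or.inl h⟩
    · exact ⟨r, s, hr, hs, Or.inr h⟩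
  haveI : Nontrivial R := by
    obtain ⟨r, _, hr, _⟩ := hcov x0 hx0
    exact ⟨⟨0, r, hr.ne⟩⟩
  have hdf : DS.DF L (fun p : (R × R) × (Fin n → R) =>
      (Fin.append ![p.1.1, p.1.2] p.2 : Fin (2 + n) → R)) := by
    refine DS.DF.pi fun i => ?_
    refine Fin.addCases (fun i => ?_) (fun i => ?_) i
    · simp only [Fin.append_left]
      fin_cases i
      · exact DS.DF.fst (DS.DF.fst DS.DF.id)
      · exact DS.DF.snd (DS.DF.fst DS.DF.id)
    · simp only [Fin.append_right]
      exact DS.DF.app (DS.DF.snd DS.DF.id) i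
  obtain ⟨r, s, hr, hs, x, hx⟩ := DS.BP.all hG hDC hLUF2 n
    (fun r s => famFiber F₁ r s ∪ famFiber F₂ r s)
    (DS.DP.or (DS.DP.ofDef hF₁ hdf) (DS.DP.ofDef hF₂ hdf))
    (fun r s hr hs => (hc₁ r s hr hs).2.1.union (hc₂ r s hr hs).2.1)
    (fun r r' s hr hs h => Set.union_subset_union (hr₁ r r' s hr hs h) (hr₂ r r' s hr hs h))
    (fun r s s' hr hs h => Set.union_subset_union (hs₁ r s s' hr hs h) (hs₂ r s s' hr hs h))
    (interior X) isOpen_interior ⟨x0, hx0⟩ hcov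
  have hsub₁ : famFiber F₁ r s ⊆ X₁ := by
    intro y hy
    rw [hU₁]
    simp only [Set.mem_iUnion]
    exact ⟨r, hr, s, hs, hy⟩
  have hsub₂ : famFiber F₂ r s ⊆ X₂ := by
    intro y hy
    rw [hU₂]
    simp only [Set.mem_iUnion]
    exact ⟨r, hr, s, hs, hy⟩
  by_cases h : (interior (famFiber F₁ r s)).Nonempty
  · exact Or.inl (h.mono (interior_mono hsub₁))
  · right
    rw [Set.not_nonempty_iff_eq_empty] at h
    rw [Set.union_comm, interior_union_isClosed_of_interior_empty (hc₂ r s hr hs).2.1 h] at hx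
    exact ⟨x, interior_mono hsub₂ hx⟩
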